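/- arXiv:1012.4435 — 3 statements merged into one kernel-verified Lean document; each statement's English description precedes it below -/
import Mathlib

section
/- Let π : A → L†(V) be a representation of a unital *-algebra, and suppose that for s = ∏ᵢ(1+aᵢ†aᵢ) ∈ A the closure of π(s) is surjective. Then the closure of π(s) equals the strong product ∏ᵢ(1 + Aᵢ*Aᵢ), where Aᵢ is the closure of π(aᵢ); in particular, the closure of π(s) is invertible with bounded inverse. -/
noncomputable section

local notation "⟪" x ", " y "⟫" => @inner ℂ _ _ x y

/-- `b` is a formal adjoint of `a` on the dense subspace `V` (membership in `L†(V)`). -/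
def FormalAdjointOn {H : Type*} [NormedAddCommGroup H] [InnerProductSpace ℂ H]
    (V : Submodule ℂ H) (a b : V →ₗ[ℂ] V) : Prop :=
  ∀ u v : V, ⟪(a u : H), (v : H)⟫ = ⟪(u : H), (b v : H)⟫

/-- The element `a ∈ L†(V)` viewed as a partially defined operator on `H`. -/
def opOf {H : Type*} [NormedAddCommGroup H] [InnerProductSpace ℂ H]
    (V : Submodule ℂ H) (a : V →ₗ[ℂ] V) : H →ₗ.[ℂ] H :=
  { domain := V, toFun := V.subtype.comp a }

/-- The graph of the composition `A ∘ B` on its natural domain `B⁻¹(dom A)`,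
as a submodule of `H × H`. -/
def compGraph {H : Type*} [NormedAddCommGroup H] [InnerProductSpace ℂ H]
    (A B : H →ₗ.[ℂ] H) : Submodule ℂ (H × H) :=
  Submodule.map ((LinearMap.fst ℂ H H).prodMap (LinearMap.snd ℂ H H))
    ((B.graph.prod A.graph) ⊓ LinearMap.ker
      (((LinearMap.snd ℂ H H).comp (LinearMap.fst ℂ (H × H) (H × H))) -
       ((LinearMap.fst ℂ H H).comp (LinearMap.snd ℂ (H × H) (H × H)))))

/-- The composition of two partially defined operators, on its natural domain. -/
def pcomp {H : Type*} [NormedAddCommGroup H] [InnerProductSpace ℂ H]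
    (A B : H →ₗ.[ℂ] H) : H →ₗ.[ℂ] H :=
  (compGraph A B).toLinearPMap

/-- The operator `1 + A*A` on its natural domain `dom(A*A) = A⁻¹(dom A*)`. -/
def onePlusAdjSelf {H : Type*} [NormedAddCommGroup H] [InnerProductSpace ℂ H]
    [CompleteSpace H] (A : H →ₗ.[ℂ] H) : H →ₗ.[ℂ] H :=
  (LinearMap.id.toPMap (⊤ : Submodule ℂ H)) + pcomp A.adjoint A

/-- Composition (on natural domains) of a finite list of partially defined
operators, the rightmost acting first. -/
def pcompList {H : Type*} [NormedAddCommGroup H] [InnerProductSpace ℂ H] :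
    List (H →ₗ.[ℂ] H) → (H →ₗ.[ℂ] H)
  | [] => LinearMap.id.toPMap (⊤ : Submodule ℂ H)
  | T :: Ts => pcomp T (pcompList Ts)

/-- Surjectivity of a partially defined operator. -/
def PSurj {H : Type*} [NormedAddCommGroup H] [InnerProductSpace ℂ H]
    (T : H →ₗ.[ℂ] H) : Prop :=
  ∀ ξ : H, ∃ x : T.domain, T x = ξ

/-- A representation `π : 𝒜 → L†(V)` of a unital `*`-algebra `𝒜` on a dense invariant
domain `V ⊆ H`: a unital algebra morphism into linear maps `V → V` such that
`π(star x)` is a formal adjoint of `π(x)`. -/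
structure RepOn (𝒜 : Type*) [Ring 𝒜] [Algebra ℂ 𝒜] [StarRing 𝒜]
    {H : Type*} [NormedAddCommGroup H] [InnerProductSpace ℂ H]
    (V : Submodule ℂ H) where
  toFun : 𝒜 → (V →ₗ[ℂ] V)
  map_one' : toFun 1 = LinearMap.id
  map_add' : ∀ x y, toFun (x + y) = toFun x + toFun y
  map_smul' : ∀ (c : ℂ) (x : 𝒜), toFun (c • x) = c • toFun x
  map_mul' : ∀ x y, toFun (x * y) = (toFun x).comp (toFun y)
  star_compat' : ∀ x, FormalAdjointOn V (toFun x) (toFun (star x))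

/-- `π̄(x)`, the closure of `π(x)`. -/
def repClosure {𝒜 : Type*} [Ring 𝒜] [Algebra ℂ 𝒜] [StarRing 𝒜]
    {H : Type*} [NormedAddCommGroup H] [InnerProductSpace ℂ H]
    {V : Submodule ℂ H} (π : RepOn 𝒜 V) (x : 𝒜) : H →ₗ.[ℂ] H :=
  (opOf V (π.toFun x)).closure

theorem mem_compGraph {H : Type*} [NormedAddCommGroup H] [InnerProductSpace ℂ H]
    {A B : H →ₗ.[ℂ] H} {x z : H} :
    (x, z) ∈ compGraph A B ↔ ∃ y, (x, y) ∈ B.graph ∧ (y, z) ∈ A.graph := by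
  simp only [compGraph, Submodule.mem_map, Submodule.mem_inf, Submodule.mem_prod,
    LinearMap.mem_ker, LinearMap.sub_apply, LinearMap.comp_apply, LinearMap.fst_apply,
    LinearMap.snd_apply, LinearMap.prodMap_apply, sub_eq_zero]
  constructor
  · rintro ⟨⟨⟨a, b⟩, c, d⟩, ⟨⟨hB, hA⟩, hbc⟩, heq⟩
    obtain ⟨rfl, rfl⟩ := Prod.mk.inj heq
    obtain rfl : b = c := hbc
    exact ⟨b, hB, hA⟩
  · rintro ⟨y, hB, hA⟩
    exact ⟨((x, y), y, z), ⟨⟨hB, hA⟩, rfl⟩, rfl⟩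

theorem mem_graph_pcomp {H : Type*} [NormedAddCommGroup H] [InnerProductSpace ℂ H]
    {A B : H →ₗ.[ℂ] H} {x z : H} :
    (x, z) ∈ (pcomp A B).graph ↔ ∃ y, (x, y) ∈ B.graph ∧ (y, z) ∈ A.graph := by
  rw [pcomp, Submodule.toLinearPMap_graph_eq, mem_compGraph]
  rintro ⟨x, z⟩ hx (rfl : x = 0)
  obtain ⟨y, hB, hA⟩ := mem_compGraph.1 hx
  obtain rfl : y = 0 := B.graph_fst_eq_zero_snd hB rfl
  exact A.graph_fst_eq_zero_snd hA rfl

theorem mem_graph_id {H : Type*} [NormedAddCommGroup H] [InnerProductSpace ℂ H] {x y : H} :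
    (x, y) ∈ ((LinearMap.id : H →ₗ[ℂ] H).toPMap ⊤).graph ↔ x = y := by
  rw [LinearPMap.mem_graph_iff]
  constructor
  · rintro ⟨u, hu, hy⟩
    exact hu.symm.trans hy
  · rintro rfl
    exact ⟨⟨x, Submodule.mem_top⟩, rfl, rfl⟩

theorem mem_graph_onePlusAdjSelf {H : Type*} [NormedAddCommGroup H] [InnerProductSpace ℂ H]
    [CompleteSpace H] {A : H →ₗ.[ℂ] H} {x y : H} :
    (x, y) ∈ (onePlusAdjSelf A).graph ↔
      ∃ w, (x, w) ∈ A.graph ∧ (w, y - x) ∈ A.adjoint.graph := by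
  rw [← mem_graph_pcomp, LinearPMap.mem_graph_iff, LinearPMap.mem_graph_iff]
  constructor
  · rintro ⟨⟨u, hu⟩, rfl, rfl⟩
    exact ⟨⟨u, hu.2⟩, rfl, (add_sub_cancel_left u _).symm⟩
  · rintro ⟨⟨u, hu⟩, rfl, h⟩
    refine ⟨⟨u, Submodule.mem_top, hu⟩, rfl, ?_⟩
    change u + pcomp A.adjoint A ⟨u, hu⟩ = y
    rw [h]
    exact add_sub_cancel u y

theorem cauchySeq_of_norm_sub_le {E F : Type*} [SeminormedAddCommGroup E]
    [SeminormedAddCommGroup F] {y : ℕ → E} {z : ℕ → F} (hy : CauchySeq y)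
    (h : ∀ m n, ‖z m - z n‖ ≤ ‖y m - y n‖) : CauchySeq z := by
  rw [Metric.cauchySeq_iff] at hy ⊢
  intro ε hε
  obtain ⟨N, hN⟩ := hy ε hε
  refine ⟨N, fun m hm n hn => lt_of_le_of_lt ?_ (hN m hm n hn)⟩
  rw [dist_eq_norm, dist_eq_norm]
  exact h m n

open Filter Topology in
/-- The composition of closed operators is closed if the inner operator is dominated in norm by
the composition. -/
theorem isClosed_setOf_comp {H : Type*} [NormedAddCommGroup H] [InnerProductSpace ℂ H]
    [CompleteSpace H] {A B : H →ₗ.[ℂ] H} (hA : A.IsClosed) (hB : B.IsClosed)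
    {p : H × H → H} (hp : Continuous p) (hp_sub : ∀ u v, p (u - v) = p u - p v)
    (hbound : ∀ x y z, (x, y) ∈ B.graph → (y, p (x, z)) ∈ A.graph → ‖y‖ ≤ ‖z‖) :
    IsClosed {q : H × H | ∃ y, (q.1, y) ∈ B.graph ∧ (y, p q) ∈ A.graph} := by
  rw [← isSeqClosed_iff_isClosed]
  intro q r hq hqr
  choose y hyB hyA using hq
  have hsnd : Tendsto (fun n => (q n).2) atTop (𝓝 r.2) := (continuous_snd.tendsto r).comp hqr
  have hfst : Tendsto (fun n => (q n).1) atTop (𝓝 r.1) := (continuous_fst.tendsto r).comp hqr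
  have hcauchy : CauchySeq y := by
    refine cauchySeq_of_norm_sub_le hsnd.cauchySeq fun m n => ?_
    refine hbound ((q m).1 - (q n).1) _ _ (B.graph.sub_mem (hyB m) (hyB n)) ?_
    have := A.graph.sub_mem (hyA m) (hyA n)
    rwa [Prod.mk_sub_mk, ← hp_sub] at this
  obtain ⟨w, hw⟩ := cauchySeq_tendsto_of_complete hcauchy
  exact ⟨w, hB.mem_of_tendsto (hfst.prodMk_nhds hw) (Eventually.of_forall hyB),
    hA.mem_of_tendsto (hw.prodMk_nhds ((hp.tendsto r).comp hqr)) (Eventually.of_forall hyA)⟩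

theorem norm_sq_add_norm_sq_le {H : Type*} [NormedAddCommGroup H] [InnerProductSpace ℂ H]
    [CompleteSpace H] {A : H →ₗ.[ℂ] H} (hd : Dense (A.domain : Set H)) {x w y : H}
    (hA : (x, w) ∈ A.graph) (hAdj : (w, y - x) ∈ A.adjoint.graph) :
    ‖x‖ ^ 2 + ‖w‖ ^ 2 ≤ ‖y‖ * ‖x‖ := by
  obtain ⟨u, hu, huw⟩ := A.mem_graph_iff.1 hA
  obtain ⟨v, hv, hvy⟩ := A.adjoint.mem_graph_iff.1 hAdj
  have h := LinearPMap.adjoint_isFormalAdjoint hd v u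
  rw [hvy, hv, huw, hu] at h
  dsimp only at h
  rw [inner_sub_left, inner_self_eq_norm_sq_to_K, inner_self_eq_norm_sq_to_K,
    sub_eq_iff_eq_add] at h
  calc ‖x‖ ^ 2 + ‖w‖ ^ 2 = RCLike.re ⟪y, x⟫ := by
        rw [h, add_comm]; norm_cast
    _ ≤ ‖y‖ * ‖x‖ := re_inner_le_norm y x

/-- `T` is a closed operator satisfying `‖x‖ ≤ ‖T x‖`. -/
def IsClosedExpanding {H : Type*} [NormedAddCommGroup H] [InnerProductSpace ℂ H]
    (T : H →ₗ.[ℂ] H) : Prop :=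
  T.IsClosed ∧ ∀ x y, (x, y) ∈ T.graph → ‖x‖ ≤ ‖y‖

theorem isClosedExpanding_onePlusAdjSelf {H : Type*} [NormedAddCommGroup H]
    [InnerProductSpace ℂ H] [CompleteSpace H] {A : H →ₗ.[ℂ] H} (hA : A.IsClosed)
    (hd : Dense (A.domain : Set H)) : IsClosedExpanding (onePlusAdjSelf A) := by
  have key : ∀ x w y, (x, w) ∈ A.graph → (w, y - x) ∈ A.adjoint.graph →
      ‖x‖ ≤ ‖y‖ ∧ ‖w‖ ≤ ‖y‖ := by
    intro x w y hxw hwy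
    have h := norm_sq_add_norm_sq_le hd hxw hwy
    have hx : ‖x‖ ≤ ‖y‖ := by
      by_contra! hlt
      nlinarith [norm_nonneg x, norm_nonneg y, sq_nonneg ‖w‖]
    refine ⟨hx, ?_⟩
    nlinarith [norm_nonneg x, norm_nonneg y, norm_nonneg w, sq_nonneg ‖x‖]
  constructor
  · have := isClosed_setOf_comp (LinearPMap.adjoint_isClosed hd) hA
      (p := fun q => q.2 - q.1) (by fun_prop)
      (fun u v => by simp only [Prod.snd_sub, Prod.fst_sub]; abel)
      (fun x w y hxw hwy => (key x w y hxw hwy).2)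
    rw [LinearPMap.IsClosed]
    convert this using 1
    ext ⟨x, y⟩
    exact mem_graph_onePlusAdjSelf
  · intro x y hxy
    obtain ⟨w, hxw, hwy⟩ := mem_graph_onePlusAdjSelf.1 hxy
    exact (key x w y hxw hwy).1

theorem IsClosedExpanding.pcomp {H : Type*} [NormedAddCommGroup H] [InnerProductSpace ℂ H]
    [CompleteSpace H] {A B : H →ₗ.[ℂ] H} (hA : IsClosedExpanding A)
    (hB : IsClosedExpanding B) : IsClosedExpanding (pcomp A B) := by
  constructor
  · have := isClosed_setOf_comp hA.1 hB.1 continuous_snd (fun _ _ => rfl)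
      (fun _ y z _ hyz => hA.2 y z hyz)
    rw [LinearPMap.IsClosed]
    convert this using 1
    ext ⟨x, y⟩
    exact mem_graph_pcomp
  · intro x z hxz
    obtain ⟨y, hxy, hyz⟩ := mem_graph_pcomp.1 hxz
    exact (hB.2 x y hxy).trans (hA.2 y z hyz)

theorem isClosedExpanding_pcompList {H : Type*} [NormedAddCommGroup H]
    [InnerProductSpace ℂ H] [CompleteSpace H] (L : List (H →ₗ.[ℂ] H))
    (hL : ∀ T ∈ L, IsClosedExpanding T) : IsClosedExpanding (pcompList L) := by
  induction L with
  | nil =>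
    constructor
    · have : IsClosed {q : H × H | q.1 = q.2} := isClosed_eq continuous_fst continuous_snd
      rw [LinearPMap.IsClosed]
      convert this using 1
      ext ⟨x, y⟩
      exact mem_graph_id
    · intro x y hxy
      rw [mem_graph_id.1 hxy]
  | cons T L ih =>
    exact (hL T List.mem_cons_self).pcomp (ih fun S hS => hL S (List.mem_cons_of_mem T hS))

/-- A surjective restriction of an expanding operator is the whole operator. -/
theorem eq_of_le_of_pSurj {H : Type*} [NormedAddCommGroup H] [InnerProductSpace ℂ H]
    {T S : H →ₗ.[ℂ] H} (hle : T ≤ S) (hsurj : PSurj T) (hS : IsClosedExpanding S) : T = S := by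
  refine LinearPMap.eq_of_eq_graph (le_antisymm (LinearPMap.le_graph_of_le hle) ?_)
  rintro ⟨x, y⟩ hxy
  obtain ⟨u, rfl⟩ := hsurj y
  have hu := S.graph.sub_mem hxy (LinearPMap.le_graph_of_le hle (T.mem_graph u))
  have hnorm := hS.2 _ _ hu
  rw [sub_self, norm_zero, norm_le_zero_iff, sub_eq_zero] at hnorm
  obtain rfl : x = u := hnorm
  exact T.mem_graph u

theorem mem_graph_opOf {H : Type*} [NormedAddCommGroup H] [InnerProductSpace ℂ H]
    {V : Submodule ℂ H} (a : V →ₗ[ℂ] V) (v : V) : ((v : H), (a v : H)) ∈ (opOf V a).graph :=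
  (opOf V a).mem_graph v

theorem FormalAdjointOn.le_adjoint {H : Type*} [NormedAddCommGroup H] [InnerProductSpace ℂ H]
    [CompleteSpace H] {V : Submodule ℂ H} (hV : Dense (V : Set H)) {a b : V →ₗ[ℂ] V}
    (h : FormalAdjointOn V a b) : opOf V a ≤ (opOf V b).adjoint :=
  LinearPMap.IsFormalAdjoint.le_adjoint (T := opOf V b) (S := opOf V a) hV
    (LinearPMap.IsFormalAdjoint.symm (T := opOf V a) (S := opOf V b) h)

theorem FormalAdjointOn.isClosable {H : Type*} [NormedAddCommGroup H] [InnerProductSpace ℂ H]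
    [CompleteSpace H] {V : Submodule ℂ H} (hV : Dense (V : Set H)) {a b : V →ₗ[ℂ] V}
    (h : FormalAdjointOn V a b) : (opOf V a).IsClosable :=
  LinearPMap.isClosable_iff_exists_closed_extension.2
    ⟨_, LinearPMap.adjoint_isClosed (T := opOf V b) hV, h.le_adjoint hV⟩

theorem LinearPMap.closure_le_of_le {R E F : Type*} [CommRing R] [AddCommGroup E]
    [AddCommGroup F] [Module R E] [Module R F] [TopologicalSpace E] [TopologicalSpace F]
    [ContinuousAdd E] [ContinuousAdd F] [TopologicalSpace R] [ContinuousSMul R E]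
    [ContinuousSMul R F] {f g : E →ₗ.[R] F} (hg : g.IsClosed) (h : f ≤ g) : f.closure ≤ g := by
  refine LinearPMap.le_of_le_graph ?_
  rw [← (hg.isClosable.leIsClosable h).graph_closure_eq_closure_graph]
  exact Submodule.topologicalClosure_minimal _ (LinearPMap.le_graph_of_le h) hg

theorem dense_domain_closure_opOf {H : Type*} [NormedAddCommGroup H] [InnerProductSpace ℂ H]
    {V : Submodule ℂ H} (hV : Dense (V : Set H)) (a : V →ₗ[ℂ] V) :
    Dense ((opOf V a).closure.domain : Set H) :=
  hV.mono (opOf V a).le_closure.1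

theorem FormalAdjointOn.le_adjoint_closure {H : Type*} [NormedAddCommGroup H]
    [InnerProductSpace ℂ H] [CompleteSpace H] {V : Submodule ℂ H} (hV : Dense (V : Set H))
    {a b : V →ₗ[ℂ] V} (h : FormalAdjointOn V a b) :
    opOf V b ≤ (opOf V a).closure.adjoint := by
  have hle : (opOf V a).closure ≤ (opOf V b).adjoint :=
    LinearPMap.closure_le_of_le (LinearPMap.adjoint_isClosed (T := opOf V b) hV)
      (h.le_adjoint hV)
  refine LinearPMap.IsFormalAdjoint.le_adjoint (dense_domain_closure_opOf hV a) fun x y => ?_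
  rw [hle.2 (y := ⟨x, hle.1 x.2⟩) rfl]
  exact LinearPMap.adjoint_isFormalAdjoint (T := opOf V b) hV _ y

theorem RepOn.opOf_le_pcompList {𝒜 : Type*} [Ring 𝒜] [Algebra ℂ 𝒜] [StarRing 𝒜]
    {H : Type*} [NormedAddCommGroup H] [InnerProductSpace ℂ H] [CompleteSpace H]
    {V : Submodule ℂ H} (hV : Dense (V : Set H)) (π : RepOn 𝒜 V) (l : List 𝒜) :
    opOf V (π.toFun (l.map fun a => 1 + star a * a).prod) ≤
      pcompList (l.map fun a => onePlusAdjSelf (repClosure π a)) := by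
  suffices h : ∀ v : V, ((v : H), (π.toFun (l.map fun a => 1 + star a * a).prod v : H)) ∈
      (pcompList (l.map fun a => onePlusAdjSelf (repClosure π a))).graph by
    refine LinearPMap.le_of_le_graph ?_
    rintro ⟨x, y⟩ hxy
    obtain ⟨v, rfl, rfl⟩ := LinearPMap.mem_graph_iff _ |>.1 hxy
    exact h v
  intro v
  induction l with
  | nil =>
    simp only [List.map_nil, List.prod_nil, π.map_one']
    exact mem_graph_id.2 rfl
  | cons a l ih =>
    simp only [List.map_cons, List.prod_cons, π.map_mul', π.map_add', π.map_one']
    refine mem_graph_pcomp.2 ⟨_, ih, mem_graph_onePlusAdjSelf.2 ?_⟩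
    rw [LinearMap.comp_apply]
    generalize π.toFun (l.map fun a => 1 + star a * a).prod v = u
    refine ⟨π.toFun a u, LinearPMap.le_graph_of_le (LinearPMap.le_closure _)
      (mem_graph_opOf _ u), ?_⟩
    change ((π.toFun a u : H), (u : H) + (π.toFun (star a) (π.toFun a u) : H) - u) ∈
      (repClosure π a).adjoint.graph
    rw [add_sub_cancel_left]
    exact LinearPMap.le_graph_of_le ((π.star_compat' a).le_adjoint_closure hV)
      (mem_graph_opOf _ (π.toFun a u))

/-- Let `π : 𝒜 → L†(V)` be a representation of a unital `*`-algebra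
and `s = ∏ᵢ (1 + aᵢ† aᵢ)`.  If the closure `π̄(s)` is surjective, then
`π̄(s) = ∏ᵢ (1 + Aᵢ*Aᵢ)` (composition on natural domains, `Aᵢ = π̄(aᵢ)`); in
particular `π̄(s)` is injective with bounded inverse. -/
theorem closure_of_rep_of_prod_one_add_star_mul
    {𝒜 : Type*} [Ring 𝒜] [Algebra ℂ 𝒜] [StarRing 𝒜] [StarModule ℂ 𝒜]
    {H : Type*} [NormedAddCommGroup H] [InnerProductSpace ℂ H] [CompleteSpace H]
    (V : Submodule ℂ H) (hV : Dense (V : Set H))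
    (π : RepOn 𝒜 V) (l : List 𝒜) (s : 𝒜)
    (hs : s = (l.map fun a => 1 + star a * a).prod)
    (T : H →ₗ.[ℂ] H) (hT : T = repClosure π s)
    (hsurj : PSurj T) :
    T = pcompList (l.map fun a => onePlusAdjSelf (repClosure π a)) ∧
    (∀ x y : T.domain, T x = T y → (x : H) = (y : H)) ∧
    (∃ C : ℝ, ∀ x : T.domain, ‖(x : H)‖ ≤ C * ‖T x‖) := by
  have hS : IsClosedExpanding (pcompList (l.map fun a => onePlusAdjSelf (repClosure π a))) := by
    refine isClosedExpanding_pcompList _ fun S hS => ?_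
    obtain ⟨a, -, rfl⟩ := List.mem_map.1 hS
    exact isClosedExpanding_onePlusAdjSelf ((π.star_compat' a).isClosable hV).closure_isClosed
      (dense_domain_closure_opOf hV _)
  have hle : T ≤ pcompList (l.map fun a => onePlusAdjSelf (repClosure π a)) := by
    rw [hT, hs]
    exact LinearPMap.closure_le_of_le hS.1 (π.opOf_le_pcompList hV l)
  have heq := eq_of_le_of_pSurj hle hsurj hS
  rw [← heq] at hS
  refine ⟨heq, fun x y hxy => ?_, 1, fun x => ?_⟩
  · have h := hS.2 _ _ (T.mem_graph (x - y))
    rwa [T.map_sub, hxy, sub_self, norm_zero, norm_le_zero_iff, Submodule.coe_sub,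
      sub_eq_zero] at h
  · rw [one_mul]
    exact hS.2 _ _ (T.mem_graph x)
end
end

section
/- Let π : A → L†(V) be a representation such that the closure π̄(s) is surjective for every s in the multiplicative set S generated by { 1+a†a : a ∈ A }. Then π̄(st) = π̄(s)·π̄(t) (strong product) for all s, t ∈ S. -/
noncomputable section

local notation "⟪" x ", " y "⟫" => @inner ℂ _ _ x y

/-- A pairing identity `⟪y, v⟫ = ⟪x, b v⟫` on a relation persists on its closure. -/
lemma inner_eq_of_mem_topologicalClosure
    {H : Type*} [NormedAddCommGroup H] [InnerProductSpace ℂ H] {V : Submodule ℂ H}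
    {G : Submodule ℂ (H × H)} {b : V →ₗ[ℂ] V}
    (hG : ∀ p ∈ G, ∀ v : V, ⟪p.2, (v : H)⟫ = ⟪p.1, (b v : H)⟫) :
    ∀ p ∈ G.topologicalClosure, ∀ v : V, ⟪p.2, (v : H)⟫ = ⟪p.1, (b v : H)⟫ := by
  intro p hp v
  have hclosed : IsClosed {q : H × H | ⟪q.2, (v : H)⟫ = ⟪q.1, (b v : H)⟫} :=
    isClosed_eq (by fun_prop) (by fun_prop)
  exact closure_minimal (fun q hq => hG q hq v) hclosed hp

lemma norm_fst_le_of_mem_topologicalClosure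
    {H : Type*} [NormedAddCommGroup H] [InnerProductSpace ℂ H]
    {G : Submodule ℂ (H × H)} (hG : ∀ p ∈ G, ‖p.1‖ ≤ ‖p.2‖) :
    ∀ p ∈ G.topologicalClosure, ‖p.1‖ ≤ ‖p.2‖ := by
  intro p hp
  have hclosed : IsClosed {q : H × H | ‖q.1‖ ≤ ‖q.2‖} :=
    isClosed_le (by fun_prop) (by fun_prop)
  exact closure_minimal hG hclosed hp

/-- A relation with a densely defined formal adjoint is single-valued. -/
lemma snd_eq_zero_of_inner_eq
    {H : Type*} [NormedAddCommGroup H] [InnerProductSpace ℂ H] {V : Submodule ℂ H}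
    (hV : Dense (V : Set H)) {G : Submodule ℂ (H × H)} {b : V →ₗ[ℂ] V}
    (hG : ∀ p ∈ G, ∀ v : V, ⟪p.2, (v : H)⟫ = ⟪p.1, (b v : H)⟫) :
    ∀ p ∈ G, p.1 = 0 → p.2 = 0 := by
  intro p hp h0
  refine hV.eq_zero_of_inner_left (𝕜 := ℂ) fun v hv => ?_
  rw [hG p hp ⟨v, hv⟩, h0, inner_zero_left]

/-- An operator with a densely defined formal adjoint is closable. -/
lemma isClosable_of_inner_eq
    {H : Type*} [NormedAddCommGroup H] [InnerProductSpace ℂ H] {V : Submodule ℂ H}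
    (hV : Dense (V : Set H)) {T : H →ₗ.[ℂ] H} {b : V →ₗ[ℂ] V}
    (hT : ∀ p ∈ T.graph, ∀ v : V, ⟪p.2, (v : H)⟫ = ⟪p.1, (b v : H)⟫) :
    T.IsClosable :=
  ⟨T.graph.topologicalClosure.toLinearPMap,
    (Submodule.toLinearPMap_graph_eq _
      (snd_eq_zero_of_inner_eq hV (inner_eq_of_mem_topologicalClosure hT))).symm⟩

lemma mem_compGraph_iff {H : Type*} [NormedAddCommGroup H] [InnerProductSpace ℂ H]
    {A B : H →ₗ.[ℂ] H} {p : H × H} :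
    p ∈ compGraph A B ↔ ∃ y, (p.1, y) ∈ B.graph ∧ (y, p.2) ∈ A.graph := by
  obtain ⟨x, z⟩ := p
  constructor
  · rintro ⟨⟨⟨a, b⟩, ⟨c, d⟩⟩, ⟨⟨hB, hA⟩, hk⟩, he⟩
    have hbc : b = c := by simpa [sub_eq_zero] using hk
    obtain ⟨rfl, rfl⟩ : a = x ∧ d = z := by simpa using he
    subst hbc
    exact ⟨b, hB, hA⟩
  · rintro ⟨y, hB, hA⟩
    exact ⟨((x, y), (y, z)), ⟨⟨hB, hA⟩, by simp⟩, by simp⟩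

lemma graph_pcomp {H : Type*} [NormedAddCommGroup H] [InnerProductSpace ℂ H]
    (A B : H →ₗ.[ℂ] H) : (pcomp A B).graph = compGraph A B := by
  refine Submodule.toLinearPMap_graph_eq _ fun p hp h0 => ?_
  obtain ⟨y, hB, hA⟩ := mem_compGraph_iff.1 hp
  exact A.graph_fst_eq_zero_snd hA (B.graph_fst_eq_zero_snd hB h0)

lemma mem_graph_opOf_iff {H : Type*} [NormedAddCommGroup H] [InnerProductSpace ℂ H]
    {V : Submodule ℂ H} {a : V →ₗ[ℂ] V} {p : H × H} :
    p ∈ (opOf V a).graph ↔ ∃ v : V, (v : H) = p.1 ∧ (a v : H) = p.2 :=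
  LinearPMap.mem_graph_iff _

/-- An operator that is bounded below by `1` cannot properly extend a surjective operator. -/
lemma eq_of_graph_le_of_pSurj {H : Type*} [NormedAddCommGroup H] [InnerProductSpace ℂ H]
    {T T' : H →ₗ.[ℂ] H} (hle : T.graph ≤ T'.graph) (hT : PSurj T)
    (hT' : ∀ p ∈ T'.graph, ‖p.1‖ ≤ ‖p.2‖) : T = T' := by
  refine LinearPMap.eq_of_eq_graph (le_antisymm hle ?_)
  rintro ⟨x, y⟩ hxy
  obtain ⟨x', hx'⟩ := hT y
  have hmem : ((x' : H), y) ∈ T.graph := hx' ▸ T.mem_graph x'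
  have hsub := hT' _ (T'.graph.sub_mem hxy (hle hmem))
  have hx : x = x' := by simpa [sub_eq_zero] using hsub
  rwa [hx]

namespace RepOn

variable {𝒜 : Type*} [Ring 𝒜] [Algebra ℂ 𝒜] [StarRing 𝒜]
  {H : Type*} [NormedAddCommGroup H] [InnerProductSpace ℂ H] {V : Submodule ℂ H}

lemma norm_le_norm_one_add_star_mul_self (π : RepOn 𝒜 V) (a : 𝒜) (v : V) :
    ‖v‖ ≤ ‖π.toFun (1 + star a * a) v‖ := by
  have hadj : ⟪(π.toFun (star a) (π.toFun a v) : H), (v : H)⟫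
      = ⟪(π.toFun a v : H), (π.toFun a v : H)⟫ := by
    rw [π.star_compat' (star a), star_star]
  have hinner : RCLike.re ⟪(π.toFun (1 + star a * a) v : H), (v : H)⟫
      = ‖v‖ ^ 2 + ‖π.toFun a v‖ ^ 2 := by
    rw [π.map_add', π.map_one', π.map_mul']
    simp only [LinearMap.add_apply, LinearMap.id_apply, LinearMap.comp_apply,
      Submodule.coe_add, inner_add_left, hadj, map_add, inner_self_eq_norm_sq,
      Submodule.coe_norm]
  have hcs : RCLike.re ⟪(π.toFun (1 + star a * a) v : H), (v : H)⟫
      ≤ ‖π.toFun (1 + star a * a) v‖ * ‖v‖ := re_inner_le_norm _ _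
  rcases (norm_nonneg v).eq_or_lt with h0 | hpos
  · rw [← h0]
    exact norm_nonneg _
  · nlinarith [sq_nonneg ‖π.toFun a v‖]

lemma norm_le_norm_of_mem_closure (π : RepOn 𝒜 V) {s : 𝒜}
    (hs : s ∈ Submonoid.closure { x : 𝒜 | ∃ a : 𝒜, x = 1 + star a * a }) :
    ∀ v : V, ‖v‖ ≤ ‖π.toFun s v‖ := by
  induction hs using Submonoid.closure_induction with
  | mem x hx =>
    obtain ⟨a, rfl⟩ := hx
    exact π.norm_le_norm_one_add_star_mul_self a
  | one => simp [π.map_one']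
  | mul x y _ _ hx hy =>
    intro v
    rw [π.map_mul']
    exact (hy v).trans (hx _)

lemma inner_eq_of_mem_graph_opOf (π : RepOn 𝒜 V) (s : 𝒜) :
    ∀ p ∈ (opOf V (π.toFun s)).graph, ∀ v : V,
      ⟪p.2, (v : H)⟫ = ⟪p.1, (π.toFun (star s) v : H)⟫ := by
  intro p hp v
  obtain ⟨u, hu, hsu⟩ := mem_graph_opOf_iff.1 hp
  rw [← hu, ← hsu, π.star_compat' s]

lemma graph_repClosure (hV : Dense (V : Set H)) (π : RepOn 𝒜 V) (s : 𝒜) :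
    (repClosure π s).graph = (opOf V (π.toFun s)).graph.topologicalClosure :=
  (isClosable_of_inner_eq hV
    (π.inner_eq_of_mem_graph_opOf s)).graph_closure_eq_closure_graph.symm

lemma inner_eq_of_mem_graph_repClosure (hV : Dense (V : Set H)) (π : RepOn 𝒜 V) (s : 𝒜) :
    ∀ p ∈ (repClosure π s).graph, ∀ v : V,
      ⟪p.2, (v : H)⟫ = ⟪p.1, (π.toFun (star s) v : H)⟫ := by
  rw [π.graph_repClosure hV]
  exact inner_eq_of_mem_topologicalClosure (π.inner_eq_of_mem_graph_opOf s)

lemma norm_fst_le_of_mem_graph_repClosure (hV : Dense (V : Set H)) (π : RepOn 𝒜 V) {s : 𝒜}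
    (hs : ∀ v : V, ‖v‖ ≤ ‖π.toFun s v‖) :
    ∀ p ∈ (repClosure π s).graph, ‖p.1‖ ≤ ‖p.2‖ := by
  rw [π.graph_repClosure hV]
  refine norm_fst_le_of_mem_topologicalClosure fun p hp => ?_
  obtain ⟨u, hu, hsu⟩ := mem_graph_opOf_iff.1 hp
  rw [← hu, ← hsu]
  exact hs u

lemma mem_graph_repClosure (hV : Dense (V : Set H)) (π : RepOn 𝒜 V) (s : 𝒜) (v : V) :
    ((v : H), (π.toFun s v : H)) ∈ (repClosure π s).graph := by
  rw [π.graph_repClosure hV]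
  exact Submodule.le_topologicalClosure _ (mem_graph_opOf_iff.2 ⟨v, rfl, rfl⟩)

end RepOn

/-- Let `π : 𝒜 → L†(V)` be a representation such that `π̄(u)` is
surjective for every `u` in the multiplicative set `S` generated by
`{ 1 + a†a : a ∈ 𝒜 }`.  Then `π̄(st)` equals the strong product `π̄(s)·π̄(t)` (the
closure of the composition on its natural domain) for all `s, t ∈ S`. -/
theorem repClosure_mul_eq_strong_product
    {𝒜 : Type*} [Ring 𝒜] [Algebra ℂ 𝒜] [StarRing 𝒜] [StarModule ℂ 𝒜]
    {H : Type*} [NormedAddCommGroup H] [InnerProductSpace ℂ H] [CompleteSpace H]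
    (V : Submodule ℂ H) (hV : Dense (V : Set H))
    (π : RepOn 𝒜 V)
    (S : Submonoid 𝒜)
    (hSgen : S = Submonoid.closure { x : 𝒜 | ∃ a : 𝒜, x = 1 + star a * a })
    (hsurj : ∀ u ∈ S, PSurj (repClosure π u)) :
    ∀ s ∈ S, ∀ t ∈ S,
      repClosure π (s * t)
        = (pcomp (repClosure π s) (repClosure π t)).closure := by
  subst hSgen
  intro s hs t ht
  have hadj : ∀ p ∈ (pcomp (repClosure π s) (repClosure π t)).graph, ∀ v : V,
      ⟪p.2, (v : H)⟫ = ⟪p.1, (π.toFun (star (s * t)) v : H)⟫ := by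
    intro p hp v
    rw [graph_pcomp] at hp
    obtain ⟨y, hty, hsy⟩ := mem_compGraph_iff.1 hp
    rw [π.inner_eq_of_mem_graph_repClosure hV s _ hsy, star_mul, π.map_mul']
    exact π.inner_eq_of_mem_graph_repClosure hV t _ hty _
  have hgraph := (isClosable_of_inner_eq hV hadj).graph_closure_eq_closure_graph
  refine eq_of_graph_le_of_pSurj ?_ (hsurj _ (mul_mem hs ht)) ?_
  · rw [← hgraph, π.graph_repClosure hV]
    refine Submodule.topologicalClosure_mono fun p hp => ?_
    obtain ⟨v, hv, hstv⟩ := mem_graph_opOf_iff.1 hp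
    rw [π.map_mul'] at hstv
    rw [graph_pcomp, mem_compGraph_iff, ← hv, ← hstv]
    exact ⟨_, π.mem_graph_repClosure hV t v, π.mem_graph_repClosure hV s _⟩
  · rw [← hgraph]
    refine norm_fst_le_of_mem_topologicalClosure fun p hp => ?_
    rw [graph_pcomp] at hp
    obtain ⟨y, hty, hsy⟩ := mem_compGraph_iff.1 hp
    exact (π.norm_fst_le_of_mem_graph_repClosure hV
      (π.norm_le_norm_of_mem_closure ht) _ hty).trans
      (π.norm_fst_le_of_mem_graph_repClosure hV (π.norm_le_norm_of_mem_closure hs) _ hsy)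
end
end

section
/- Suppose A ⊆ B are unital *-algebras such that every element of S = { ∏ᵢ(1+aᵢ†aᵢ) : aᵢ ∈ A } is invertible in B. If a representation π : A → L†(V) extends to a representation π̃ : B → L†(V), then π is integrable, i.e., π̄(a†) = π̄(a)* for all a ∈ A. In particular, every representation of a symmetric *-algebra (one where each 1+a†a is invertible) is integrable. -/
noncomputable section

local notation "⟪" x ", " y "⟫" => @inner ℂ _ _ x y

/-- The adjoint of a subspace of `E × F` only depends on its closure. -/
theorem Submodule.adjoint_topologicalClosure {E F : Type*}
    [NormedAddCommGroup E] [InnerProductSpace ℂ E]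
    [NormedAddCommGroup F] [InnerProductSpace ℂ F] (G : Submodule ℂ (E × F)) :
    G.topologicalClosure.adjoint = G.adjoint := by
  ext x
  simp only [Submodule.mem_adjoint_iff]
  refine ⟨fun h a b hab => h a b (G.le_topologicalClosure hab), fun h a b hab => ?_⟩
  have hclosed : IsClosed {q : E × F | inner ℂ q.2 x.1 - inner ℂ q.1 x.2 = 0} :=
    isClosed_eq (by fun_prop) continuous_const
  exact closure_minimal (fun q hq => h q.1 q.2 hq) hclosed hab

/-- A closable densely defined operator has the same adjoint as its closure. -/
theorem LinearPMap.IsClosable.adjoint_closure {E F : Type*}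
    [NormedAddCommGroup E] [InnerProductSpace ℂ E] [CompleteSpace E]
    [NormedAddCommGroup F] [InnerProductSpace ℂ F] {T : E →ₗ.[ℂ] F}
    (hT : T.IsClosable) (hd : Dense (T.domain : Set E)) :
    T.closure.adjoint = T.adjoint := by
  apply LinearPMap.eq_of_eq_graph
  rw [LinearPMap.adjoint_graph_eq_graph_adjoint hd,
    LinearPMap.adjoint_graph_eq_graph_adjoint (hd.mono T.le_closure.1 : Dense (T.closure.domain : Set E)),
    ← hT.graph_closure_eq_closure_graph, Submodule.adjoint_topologicalClosure]

/-- If a subspace `M` of `E × F` contains the closure of `G` and no nonzero element of `M` is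
orthogonal to `G`, then `M` is contained in the closure of `G`. -/
theorem Submodule.le_topologicalClosure_of_prod_orthogonal {E F : Type*}
    [NormedAddCommGroup E] [InnerProductSpace ℂ E] [CompleteSpace E]
    [NormedAddCommGroup F] [InnerProductSpace ℂ F] [CompleteSpace F]
    {G M : Submodule ℂ (E × F)} (hGM : G.topologicalClosure ≤ M)
    (h : ∀ p ∈ M, (∀ q ∈ G, inner ℂ q.1 p.1 + inner ℂ q.2 p.2 = 0) → p = 0) :
    M ≤ G.topologicalClosure := by
  intro p hp
  let e := WithLp.prodContinuousLinearEquiv 2 ℂ E F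
  let K : Submodule ℂ (WithLp 2 (E × F)) :=
    G.topologicalClosure.comap (e : WithLp 2 (E × F) →ₗ[ℂ] E × F)
  have hK : IsClosed (K : Set (WithLp 2 (E × F))) :=
    G.isClosed_topologicalClosure.preimage e.continuous
  have : CompleteSpace K := hK.completeSpace_coe
  obtain ⟨y, hy, z, hz, hyz⟩ := K.exists_add_mem_mem_orthogonal (e.symm p)
  have hpyz : p = e y + e z := by rw [← map_add, ← hyz, e.apply_symm_apply]
  have hzM : e z ∈ M := by
    rw [show e z = p - e y by rw [hpyz, add_sub_cancel_left]]
    exact M.sub_mem hp (hGM hy)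
  have hz0 : e z = 0 := by
    refine h _ hzM fun q hq => ?_
    have hqK : e.symm q ∈ K := by
      change e (e.symm q) ∈ G.topologicalClosure
      rw [e.apply_symm_apply]
      exact G.le_topologicalClosure hq
    exact (WithLp.prod_inner_apply _ _).symm.trans (hz _ hqK)
  rw [hpyz, hz0, add_zero]
  exact hy

/-- If `T` and `S` are formal adjoints on a dense domain and `1 + T S` is surjective there,
then the closure of `S` is the adjoint of the closure of `T`. -/
theorem FormalAdjointOn.closure_eq_adjoint_closure {H : Type*} [NormedAddCommGroup H]
    [InnerProductSpace ℂ H] [CompleteSpace H] {V : Submodule ℂ H} (hV : Dense (V : Set H))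
    {T S : V →ₗ[ℂ] V} (hTS : FormalAdjointOn V T S)
    (hsurj : Function.Surjective (LinearMap.id + T.comp S : V →ₗ[ℂ] V)) :
    (opOf V S).closure = (opOf V T).closure.adjoint := by
  have hadj : (opOf V T).IsFormalAdjoint (opOf V S) := hTS
  have hT : (opOf V T).IsClosable := LinearPMap.isClosable_iff_exists_closed_extension.2
    ⟨(opOf V S).adjoint, LinearPMap.adjoint_isClosed hV, hadj.symm.le_adjoint hV⟩
  have hle : opOf V S ≤ (opOf V T).adjoint := hadj.le_adjoint hV
  have hcl : (opOf V T).adjoint.IsClosed := LinearPMap.adjoint_isClosed hV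
  have hS : (opOf V S).IsClosable := hcl.isClosable.leIsClosable hle
  rw [hT.adjoint_closure hV]
  apply LinearPMap.eq_of_eq_graph
  rw [← hS.graph_closure_eq_closure_graph]
  have hGM : (opOf V S).graph.topologicalClosure ≤ (opOf V T).adjoint.graph :=
    Submodule.topologicalClosure_minimal _ (LinearPMap.le_graph_of_le hle) hcl
  refine le_antisymm hGM (Submodule.le_topologicalClosure_of_prod_orthogonal hGM ?_)
  rintro ⟨x, y⟩ hxy horth
  have hy : ∀ v : V, ⟪((T v : V) : H), x⟫ = ⟪(v : H), y⟫ := fun v => by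
    rw [LinearPMap.adjoint_graph_eq_graph_adjoint hV, Submodule.mem_adjoint_iff] at hxy
    exact sub_eq_zero.1 (hxy _ _ ((opOf V T).mem_graph v))
  have hx : x = 0 := by
    refine hV.eq_zero_of_inner_right ℂ fun v hv => ?_
    obtain ⟨w, hw⟩ := hsurj ⟨v, hv⟩
    have hwx := horth _ ((opOf V S).mem_graph w)
    have hv' : v = (w : H) + (T (S w) : V) := congrArg Subtype.val hw.symm
    rw [hv', inner_add_left, hy]
    exact hwx
  subst hx
  have hy0 : y = 0 := hV.eq_zero_of_inner_right ℂ fun v hv => by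
    rw [← hy ⟨v, hv⟩, inner_zero_right]
  rw [hy0, Prod.mk_zero_zero]

/-- A representation sends units to surjective operators. -/
theorem RepOn.surjective_of_isUnit {𝒜 : Type*} [Ring 𝒜] [Algebra ℂ 𝒜] [StarRing 𝒜]
    {H : Type*} [NormedAddCommGroup H] [InnerProductSpace ℂ H] {V : Submodule ℂ H}
    (π : RepOn 𝒜 V) {x : 𝒜} (hx : IsUnit x) : Function.Surjective (π.toFun x) := by
  obtain ⟨y, hy⟩ := hx.exists_right_inv
  intro v
  refine ⟨π.toFun y v, ?_⟩
  rw [← LinearMap.comp_apply, ← π.map_mul', hy, π.map_one', LinearMap.id_apply]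

/-- Suppose `𝒜 ⊆ ℬ` are unital `*`-algebras (via an injective
`*`-algebra morphism `ι`) such that every element of
`S = { ∏ᵢ (1 + aᵢ†aᵢ) : aᵢ ∈ 𝒜 }` is invertible in `ℬ`.  If a representation
`π : 𝒜 → L†(V)` extends to a representation `π̃ : ℬ → L†(V)`, then `π` is integrable:
`π̄(a†) = π̄(a)*` for all `a ∈ 𝒜`.  In particular, if `ℬ` is symmetric (each
`1 + b†b` is invertible), every representation of `ℬ` is integrable. -/
theorem integrable_of_extension_inverting
    {𝒜 : Type*} [Ring 𝒜] [Algebra ℂ 𝒜] [StarRing 𝒜] [StarModule ℂ 𝒜]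
    {ℬ : Type*} [Ring ℬ] [Algebra ℂ ℬ] [StarRing ℬ] [StarModule ℂ ℬ]
    {H : Type*} [NormedAddCommGroup H] [InnerProductSpace ℂ H] [CompleteSpace H]
    (V : Submodule ℂ H) (hV : Dense (V : Set H))
    (ι : 𝒜 →⋆ₐ[ℂ] ℬ) (hι : Function.Injective ι)
    (hinv : ∀ l : List 𝒜, IsUnit (ι ((l.map fun a => 1 + star a * a).prod)))
    (π : RepOn 𝒜 V) (πt : RepOn ℬ V)
    (hext : ∀ a : 𝒜, πt.toFun (ι a) = π.toFun a) :
    (∀ a : 𝒜, repClosure π (star a) = (repClosure π a).adjoint) ∧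
    ((∀ b : ℬ, IsUnit (1 + star b * b)) →
      ∀ (ρ : RepOn ℬ V) (b : ℬ),
        repClosure ρ (star b) = (repClosure ρ b).adjoint) := by
  have key : ∀ (ρ : RepOn ℬ V) (b : ℬ), IsUnit (1 + b * star b) →
      repClosure ρ (star b) = (repClosure ρ b).adjoint := fun ρ b hb => by
    refine FormalAdjointOn.closure_eq_adjoint_closure hV (ρ.star_compat' b) ?_
    rw [← ρ.map_one', ← ρ.map_mul', ← ρ.map_add']
    exact ρ.surjective_of_isUnit hb
  refine ⟨fun a => ?_, fun hb ρ b => key ρ b (by simpa using hb (star b))⟩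
  have h := key πt (ι a) (by simpa [map_star] using hinv [star a])
  rwa [← map_star, repClosure, repClosure, hext, hext] at h
end
end
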